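/- For n = 2k with k ≥ 2, in the regular 2 × n grid, the tour produced by an optimal algorithm has minimum edge length exactly √(1 + (k-1)²); i.e., there exists a Hamiltonian cycle on the 2n grid points whose minimum Euclidean edge length equals √(1 + (k-1)²), and no Hamiltonian cycle has a larger minimum edge length. -/

import Mathlib

/-- The weave tour, as a function of the position `t < 4k`. -/
def weaveX (k t : ℕ) : ℤ :=
  if t < 2 * k then (if t % 2 = 0 then 1 + t / 2 else 1 + t / 2 + k)
  else (if t % 2 = 0 then 1 + t / 2 - k else 1 + t / 2)

def weaveY (k t : ℕ) : ℤ :=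
  if t < 2 * k then (if t % 2 = 0 then 1 else 2)
  else (if t % 2 = 0 then 2 else 1)

lemma weave_far (k : ℕ) (hk : 2 ≤ k) (a b c d : ℤ)
    (h : (k : ℤ) ≤ a - b ∨ (k : ℤ) ≤ b - a ∨
      ((a - b = k - 1 ∨ b - a = k - 1) ∧ (c - d = 1 ∨ d - c = 1))) :
    1 + ((k : ℤ) - 1) ^ 2 ≤ (a - b) ^ 2 + (c - d) ^ 2 := by
  have hk' : (2 : ℤ) ≤ k := by exact_mod_cast hk
  rcases h with h | h | ⟨h | h, h' | h'⟩
  · nlinarith [sq_nonneg (c - d)]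
  · nlinarith [sq_nonneg (c - d)]
  all_goals
    have e1 : (a - b) ^ 2 = ((k : ℤ) - 1) ^ 2 := by
      first
      | rw [h]
      | rw [← h]; ring
    have e2 : (c - d) ^ 2 = 1 := by
      first
      | rw [h']; norm_num
      | rw [show c - d = -1 by omega]; norm_num
    omega

lemma weave_step (k t : ℕ) (hk : 2 ≤ k) (ht : t + 1 < 4 * k) :
    1 + ((k : ℤ) - 1) ^ 2 ≤ (weaveX k t - weaveX k (t + 1)) ^ 2 +
      (weaveY k t - weaveY k (t + 1)) ^ 2 := by
  apply weave_far k hk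
  unfold weaveX weaveY
  split_ifs <;> push_cast <;>
    first
    | omega
    | exact Or.inr (Or.inr ⟨by omega, by norm_num⟩)

lemma weave_last (k t : ℕ) (hk : 2 ≤ k) (ht : t + 1 = 4 * k) :
    1 + ((k : ℤ) - 1) ^ 2 ≤ (weaveX k t - weaveX k 0) ^ 2 +
      (weaveY k t - weaveY k 0) ^ 2 := by
  apply weave_far k hk
  unfold weaveX weaveY
  split_ifs <;> push_cast <;> omega

lemma weave_inj (k s t : ℕ) (hs : s < 4 * k) (ht : t < 4 * k)
    (h1 : weaveX k s = weaveX k t) (h2 : weaveY k s = weaveY k t) : s = t := by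
  unfold weaveX at h1
  unfold weaveY at h2
  split_ifs at h1 h2 <;> omega

lemma weave_bounds (k t : ℕ) (ht : t < 4 * k) :
    1 ≤ weaveX k t ∧ weaveX k t ≤ 2 * k ∧ 1 ≤ weaveY k t ∧ weaveY k t ≤ 2 := by
  unfold weaveX weaveY
  split_ifs <;> omega

lemma weave_surj (k : ℕ) (x y : ℤ) (h1 : 1 ≤ x) (h2 : x ≤ 2 * k) (h3 : 1 ≤ y) (h4 : y ≤ 2) :
    ∃ t, t < 4 * k ∧ weaveX k t = x ∧ weaveY k t = y := by
  have hy : y = 1 ∨ y = 2 := by omega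
  rcases hy with rfl | rfl <;> rcases le_or_gt x k with hx | hx
  · refine ⟨(2 * (x - 1)).toNat, by omega, ?_, ?_⟩ <;>
      (first | unfold weaveX | unfold weaveY) <;> split_ifs <;> omega
  · refine ⟨(2 * (x - 1) + 1).toNat, by omega, ?_, ?_⟩ <;>
      (first | unfold weaveX | unfold weaveY) <;> split_ifs <;> omega
  · refine ⟨(2 * (x - 1) + 2 * k).toNat, by omega, ?_, ?_⟩ <;>
      (first | unfold weaveX | unfold weaveY) <;> split_ifs <;> omega
  · refine ⟨(2 * (x - k - 1) + 1).toNat, by omega, ?_, ?_⟩ <;>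
      (first | unfold weaveX | unfold weaveY) <;> split_ifs <;> omega

theorem stmt_19 (k n : ℕ) (hk : 2 ≤ k) (hn : n = 2*k)
    (dist : ℤ × ℤ → ℤ × ℤ → ℝ)
    (hdist : ∀ p q, dist p q = Real.sqrt (((p.1 - q.1 : ℤ) : ℝ)^2 + ((p.2 - q.2 : ℤ) : ℝ)^2)) :
    (∃ f : ZMod (2 * n) → ℤ × ℤ, Function.Injective f ∧
      (∀ p : ℤ × ℤ, (1 ≤ p.1 ∧ p.1 ≤ (n : ℤ) ∧ 1 ≤ p.2 ∧ p.2 ≤ 2) ↔ p ∈ Set.range f) ∧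
      (∀ i : ZMod (2 * n), Real.sqrt (1 + ((k:ℝ) - 1)^2) ≤ dist (f i) (f (i + 1))) ∧
      (∃ i : ZMod (2 * n), dist (f i) (f (i + 1)) = Real.sqrt (1 + ((k:ℝ) - 1)^2))) ∧
    (∀ f : ZMod (2 * n) → ℤ × ℤ, Function.Injective f →
      (∀ p : ℤ × ℤ, (1 ≤ p.1 ∧ p.1 ≤ (n : ℤ) ∧ 1 ≤ p.2 ∧ p.2 ≤ 2) ↔ p ∈ Set.range f) →
      ∃ i : ZMod (2 * n), dist (f i) (f (i + 1)) ≤ Real.sqrt (1 + ((k:ℝ) - 1)^2)) := by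
  subst hn
  have hN : NeZero (2 * (2 * k)) := ⟨by omega⟩
  have hN1 : Fact (1 < 2 * (2 * k)) := ⟨by omega⟩
  have key : ∀ p q : ℤ × ℤ, 1 + ((k : ℤ) - 1) ^ 2 ≤ (p.1 - q.1) ^ 2 + (p.2 - q.2) ^ 2 →
      Real.sqrt (1 + ((k:ℝ) - 1)^2) ≤ dist p q := by
    intro p q h
    rw [hdist]
    apply Real.sqrt_le_sqrt
    exact_mod_cast h
  have key2 : ∀ p q : ℤ × ℤ, (p.1 - q.1) ^ 2 + (p.2 - q.2) ^ 2 ≤ 1 + ((k : ℤ) - 1) ^ 2 →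
      dist p q ≤ Real.sqrt (1 + ((k:ℝ) - 1)^2) := by
    intro p q h
    rw [hdist]
    apply Real.sqrt_le_sqrt
    exact_mod_cast h
  have hlt : ∀ i : ZMod (2 * (2 * k)), i.val < 4 * k := by
    intro i
    have := ZMod.val_lt i
    omega
  have hstep : ∀ i : ZMod (2 * (2 * k)), 1 + ((k : ℤ) - 1) ^ 2 ≤
      (weaveX k i.val - weaveX k (i + 1).val) ^ 2 +
      (weaveY k i.val - weaveY k (i + 1).val) ^ 2 := by
    intro i
    have hi := hlt i
    rw [ZMod.val_add, ZMod.val_one]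
    rcases Nat.lt_or_ge (i.val + 1) (4 * k) with h | h
    · rw [Nat.mod_eq_of_lt (by omega)]
      exact weave_step k _ hk h
    · have e : i.val + 1 = 2 * (2 * k) := by omega
      rw [e, Nat.mod_self]
      exact weave_last k _ hk (by omega)
  refine ⟨⟨fun i => (weaveX k i.val, weaveY k i.val), ?_, ?_, ?_, ?_⟩, ?_⟩
  · intro i j h
    have h1 := congrArg Prod.fst h
    have h2 := congrArg Prod.snd h
    exact ZMod.val_injective _ (weave_inj k _ _ (hlt i) (hlt j) h1 h2)
  · rintro ⟨x, y⟩
    constructor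
    · rintro ⟨h1, h2, h3, h4⟩
      push_cast at h2
      obtain ⟨t, ht, hx, hy⟩ := weave_surj k x y h1 h2 h3 h4
      refine ⟨(t : ZMod (2 * (2 * k))), ?_⟩
      have : (t : ZMod (2 * (2 * k))).val = t := ZMod.val_cast_of_lt (by omega)
      simp only [this, hx, hy]
    · rintro ⟨i, hi⟩
      have h1 := congrArg Prod.fst hi
      have h2 := congrArg Prod.snd hi
      have := weave_bounds k i.val (hlt i)
      simp only at h1 h2
      rw [h1, h2] at this
      push_cast
      exact this
  · intro i
    exact key _ _ (hstep i)
  · refine ⟨1, le_antisymm (key2 _ _ ?_) (key _ _ (hstep 1))⟩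
    have e2 : ((1 : ZMod (2 * (2 * k))) + 1).val = 2 := by
      rw [ZMod.val_add, ZMod.val_one]
      exact Nat.mod_eq_of_lt (by linarith)
    simp only [e2, ZMod.val_one]
    have a1 : weaveX k 1 = 1 + k := by
      have h : 1 < 2 * k := by linarith
      simp [weaveX, h]
    have a2 : weaveX k 2 = 2 := by unfold weaveX; split_ifs <;> norm_num <;> omega
    have a3 : weaveY k 1 = 2 := by
      have h : 1 < 2 * k := by linarith
      simp [weaveY, h]
    have a4 : weaveY k 2 = 1 := by unfold weaveY; split_ifs <;> omega
    rw [a1, a2, a3, a4]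
    apply le_of_eq
    ring
  · intro f hf hr
    by_contra! hcon
    -- every edge spans at least `k` columns
    have hmem : ∀ i, 1 ≤ (f i).1 ∧ (f i).1 ≤ 2 * k ∧ 1 ≤ (f i).2 ∧ (f i).2 ≤ 2 := by
      intro i
      have := (hr (f i)).2 ⟨i, rfl⟩
      push_cast at this
      exact this
    have hfar : ∀ i, (k : ℤ) ≤ (f i).1 - (f (i + 1)).1 ∨ (k : ℤ) ≤ (f (i + 1)).1 - (f i).1 := by
      intro i
      by_contra! h
      refine absurd (key2 (f i) (f (i + 1)) ?_) (not_le.2 (hcon i))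
      have m1 := hmem i
      have m2 := hmem (i + 1)
      have b1 : ((f i).1 - (f (i + 1)).1) ^ 2 ≤ ((k : ℤ) - 1) ^ 2 :=
        sq_le_sq' (by omega) (by omega)
      have b2 : ((f i).2 - (f (i + 1)).2) ^ 2 ≤ 1 ^ 2 :=
        sq_le_sq' (by omega) (by omega)
      linarith
    have hnb : ∀ i, (f i).1 = k → (f (i + 1)).1 = 2 * k ∧ (f (i - 1)).1 = 2 * k := by
      intro i hi
      have h1 := hfar i
      have h2 := hfar (i - 1)
      rw [sub_add_cancel] at h2
      have m1 := hmem (i + 1)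
      have m2 := hmem (i - 1)
      omega
    obtain ⟨a, ha⟩ := (hr ((k : ℤ), 1)).1 (by push_cast; refine ⟨?_, ?_, ?_, ?_⟩ <;> first | omega | norm_num)
    obtain ⟨b, hb⟩ := (hr ((k : ℤ), 2)).1 (by push_cast; refine ⟨?_, ?_, ?_, ?_⟩ <;> first | omega | norm_num)
    have hab : a ≠ b := by
      rintro rfl
      rw [ha] at hb
      simp at hb
    have small : ∀ m : ℕ, 0 < m → m ≤ 4 → (m : ZMod (2 * (2 * k))) ≠ 0 := by
      intro m h0 h4 h
      rw [ZMod.natCast_eq_zero_iff] at h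
      have := Nat.le_of_dvd h0 h
      omega
    have h2 : (2 : ZMod (2 * (2 * k))) ≠ 0 := by exact_mod_cast small 2 (by omega) (by omega)
    have h4 : (4 : ZMod (2 * (2 * k))) ≠ 0 := by exact_mod_cast small 4 (by omega) (by omega)
    have na := hnb a (by rw [ha])
    have nb := hnb b (by rw [hb])
    have hdiff : ∀ i j, (f i).1 = 2 * k → (f j).1 = 2 * k → i ≠ j → (f i).2 ≠ (f j).2 := by
      intro i j hi hj hij h
      exact hij (hf (Prod.ext (hi.trans hj.symm) h))
    have c1 := hdiff _ _ na.1 na.2 (fun h => h2 (by linear_combination h))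
    have c2 := hdiff _ _ nb.1 nb.2 (fun h => h2 (by linear_combination h))
    have c3 := hdiff _ _ na.1 nb.1 (fun h => hab (by linear_combination h))
    have c4 : a + 1 = b - 1 := by
      by_contra h
      have c5 := hdiff _ _ na.1 nb.2 h
      have := hmem (a + 1)
      have := hmem (b + 1)
      have := hmem (b - 1)
      omega
    have c5 : a - 1 = b + 1 := by
      by_contra h
      have c6 := hdiff _ _ na.2 nb.1 h
      have := hmem (a + 1)
      have := hmem (a - 1)
      have := hmem (b + 1)
      omega
    exact h4 (by linear_combination c4 - c5)
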